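/- Let q be an odd prime power, k ∈ F_q a nonzero element, and let V ⊂ P³ over F_q be the reducible cubic surface defined by x(yz + k·w²) = 0, consisting of the non-degenerate quadratic cone Q: yz + kw² = 0 and the plane E: x = 0 (which does not meet the cusp (1:0:0:0) of Q). Then there is a surjective group homomorphism MW(V) → ℤ ⊕ ℤ/2ℤ. The ℤ-component is induced by the map sending a smooth point to 0 or 1 according to whether it lies on E or on Q, and the ℤ/2ℤ-component is induced by the map sending (0:y:z:w) ∈ E to χ₂(k(yz + kw²)) and (x:y:z:w) ∈ Q to χ₂(xy), respectively χ₂(−kxz) when y = 0, where χ₂ is the quadratic character of F_q*. -/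

import Mathlib

open MvPolynomial FreeAbelianGroup

noncomputable section

/-- Points of `P³` over `F`. -/
abbrev Pt (F : Type*) [Field F] := Projectivization F (Fin 4 → F)

/-- The cubic form `x(yz + k·w²)` defining the reducible surface, over any commutative
ring (so that it can also be evaluated on polynomial entries). -/
def cubicF {R : Type*} [CommRing R] (k : R) (v : Fin 4 → R) : R :=
  v 0 * (v 1 * v 2 + k * v 3 ^ 2)

/-- The gradient of `x(yz + k·w²)`. -/
def gradF {R : Type*} [CommRing R] (k : R) (v : Fin 4 → R) : Fin 4 → R :=
  ![v 1 * v 2 + k * v 3 ^ 2, v 0 * v 2, v 0 * v 1, 2 * k * v 0 * v 3]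

variable (F : Type*) [Field F]

/-- The smooth (= non-singular) `F`-rational points of the surface `x(yz + k·w²) = 0`:
points on the surface where the gradient of the defining form does not vanish. -/
def Reg (k : F) := {p : Pt F // cubicF k p.rep = 0 ∧ gradF k p.rep ≠ 0}

/-- The collinearity relation: there is a line (spanned by the linearly independent
vectors `a`, `b`), not contained in the surface, whose intersection cycle with the
surface is `pts 0 + pts 1 + pts 2`; this is encoded by the factorization of the binary
cubic form obtained by restricting the surface equation to the line into the three linear
forms corresponding to the parameters `(s i, t i)` of the three points, with a nonzero
constant `c`. -/
def Col (k : F) (pts : Fin 3 → Pt F) : Prop :=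
  ∃ a b : Fin 4 → F, LinearIndependent F ![a, b] ∧
    ∃ c : F, c ≠ 0 ∧ ∃ s t : Fin 3 → F,
      (∀ i, ∃ h : s i • a + t i • b ≠ 0, Projectivization.mk F _ h = pts i) ∧
      cubicF (C k : MvPolynomial (Fin 2) F) (fun j => C (a j) * X 0 + C (b j) * X 1) =
        C c * ∏ i : Fin 3,
          (C (t i) * (X 0 : MvPolynomial (Fin 2) F) - C (s i) * X 1)

/-- The relations defining the Mordell-Weil group. -/
def RelSet (k : F) : Set (FreeAbelianGroup (Reg F k)) :=
  {g | ∃ x y : Fin 3 → Reg F k,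
        Col F k (fun i => (x i).1) ∧ Col F k (fun i => (y i).1) ∧
        g = of (x 0) + of (x 1) + of (x 2) - of (y 0) - of (y 1) - of (y 2)}

/-- The subgroup `N` of relations inside the free abelian group on the smooth points. -/
def Nsub (k : F) : AddSubgroup (FreeAbelianGroup (Reg F k)) :=
  AddSubgroup.closure (RelSet F k)

/-- The augmentation homomorphism `ℤ[V^reg(F)] → ℤ`. -/
def aug (k : F) : FreeAbelianGroup (Reg F k) →+ ℤ :=
  FreeAbelianGroup.lift fun _ => (1 : ℤ)

/-- The Mordell-Weil group of the surface: the kernel of the augmentation map on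
`ℤ[V^reg(F)]/N`, realized as the image in the quotient of the degree-zero part of the
free abelian group. -/
def MW (k : F) : AddSubgroup (FreeAbelianGroup (Reg F k) ⧸ Nsub F k) :=
  (aug F k).ker.map (QuotientAddGroup.mk' (Nsub F k))

open Classical in
/-- The quadratic character of `F*`, written additively with values in `ℤ/2ℤ`:
squares go to `0`, non-squares to `1`. -/
def chi2 (a : F) : ZMod 2 := if IsSquare a then 0 else 1

open Classical in
/-- The `ℤ`-component on points: `0` on the plane `E : x = 0` and `1` on the cone `Q`. -/
def mComp (k : F) (p : Reg F k) : ℤ := if p.1.rep 0 = 0 then 0 else 1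

open Classical in
/-- The `ℤ/2ℤ`-component on points: `χ₂(k(yz + kw²))` on the plane `E : x = 0`, and
`χ₂(xy)` (respectively `χ₂(-kxz)` when `y = 0`) on the cone `Q`. -/
def cComp (k : F) (p : Reg F k) : ZMod 2 :=
  if p.1.rep 0 = 0 then chi2 F (k * (p.1.rep 1 * p.1.rep 2 + k * p.1.rep 3 ^ 2))
  else if p.1.rep 1 = 0 then chi2 F (-k * p.1.rep 0 * p.1.rep 2)
  else chi2 F (p.1.rep 0 * p.1.rep 1)

end


namespace MWaux

def quadQ {R : Type*} [CommRing R] (k : R) (v : Fin 4 → R) : R := v 1 * v 2 + k * v 3 ^ 2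

open Classical in
noncomputable def cV (F : Type*) [Field F] (k : F) (v : Fin 4 → F) : ZMod 2 :=
  if v 0 = 0 then chi2 F (k * (v 1 * v 2 + k * v 3 ^ 2))
  else if v 1 = 0 then chi2 F (-k * v 0 * v 2)
  else chi2 F (v 0 * v 1)

open Classical in
noncomputable def mV (F : Type*) [Field F] (v : Fin 4 → F) : ℤ := if v 0 = 0 then 0 else 1

theorem chi2_sq_mul {F : Type*} [Field F] (u a : F) (hu : u ≠ 0) :
    chi2 F (u ^ 2 * a) = chi2 F a := by
  unfold chi2
  have : IsSquare (u ^ 2 * a) ↔ IsSquare a := by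
    constructor
    · rintro ⟨r, hr⟩
      refine ⟨r / u, ?_⟩
      field_simp
      linear_combination hr
    · rintro ⟨r, hr⟩
      exact ⟨u * r, by rw [hr]; ring⟩
  by_cases h : IsSquare a
  · rw [if_pos h, if_pos (this.2 h)]
  · rw [if_neg h, if_neg (fun h' => h (this.1 h'))]

theorem chi2_mul {F : Type*} [Field F] [Fintype F] (a b : F) (ha : a ≠ 0) (hb : b ≠ 0) :
    chi2 F (a * b) = chi2 F a + chi2 F b := by
  classical
  unfold chi2
  have key : ∀ x : F, x ≠ 0 → (IsSquare x ↔ quadraticChar F x = 1) := fun x hx =>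
    (quadraticChar_one_iff_isSquare hx).symm
  rw [key a ha, key b hb, key _ (mul_ne_zero ha hb), map_mul]
  rcases quadraticChar_dichotomy ha with h | h <;> rcases quadraticChar_dichotomy hb with h' | h' <;>
    rw [h, h'] <;> norm_num <;> decide

theorem chi2_three {F : Type*} [Field F] [Fintype F] (a b c r : F) (ha : a ≠ 0) (hb : b ≠ 0)
    (hc : c ≠ 0) (h : a * b * c = r ^ 2) : chi2 F a + chi2 F b + chi2 F c = 0 := by
  rw [← chi2_mul a b ha hb, ← chi2_mul _ c (mul_ne_zero ha hb) hc, h]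
  unfold chi2
  rw [if_pos ⟨r, by ring⟩]

theorem cV_smul {F : Type*} [Field F] (k u : F) (hu : u ≠ 0) (v : Fin 4 → F) :
    cV F k (u • v) = cV F k v := by
  have s0 : ∀ i, (u • v) i = u * v i := fun i => rfl
  have z : ∀ i, (u • v) i = 0 ↔ v i = 0 := by intro i; simp [s0, hu]
  unfold cV
  by_cases h0 : v 0 = 0
  · rw [if_pos h0, if_pos ((z 0).2 h0), ← chi2_sq_mul u (k * (v 1 * v 2 + k * v 3 ^ 2)) hu]
    simp only [s0]
    congr 1; ring
  · rw [if_neg h0, if_neg (fun h => h0 ((z 0).1 h))]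
    by_cases h1 : v 1 = 0
    · rw [if_pos h1, if_pos ((z 1).2 h1), ← chi2_sq_mul u (-k * v 0 * v 2) hu]
      simp only [s0]
      congr 1; ring
    · rw [if_neg h1, if_neg (fun h => h1 ((z 1).1 h)), ← chi2_sq_mul u (v 0 * v 1) hu]
      simp only [s0]
      congr 1; ring

theorem mV_smul {F : Type*} [Field F] (u : F) (hu : u ≠ 0) (v : Fin 4 → F) :
    mV F (u • v) = mV F v := by
  unfold mV
  by_cases h0 : v 0 = 0
  · rw [if_pos h0, if_pos (by simp [h0])]
  · rw [if_neg h0, if_neg (by simp [h0, hu])]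

theorem core {F : Type*} [Field F] [Fintype F] (k : F) (hk : k ≠ 0)
    (e p r : Fin 4 → F) (α β D : F) (hD : D ≠ 0) (hβ : β ≠ 0)
    (he0 : e 0 = 0) (he : quadQ k e ≠ 0) (hp0 : p 0 ≠ 0) (hpQ : quadQ k p = 0)
    (hr : ∀ i, D * r i = β * p i + α * e i)
    (hB : α * quadQ k e + β * (e 1 * p 2 + e 2 * p 1 + 2 * k * e 3 * p 3) = 0)
    (hpreg : p 1 ≠ 0 ∨ p 2 ≠ 0) (hrreg : r 1 ≠ 0 ∨ r 2 ≠ 0) :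
    cV F k e + cV F k p + cV F k r = 0 ∧ mV F e + mV F p + mV F r = 2 := by
  have hr' : D • r = fun i => β * p i + α * e i := by
    funext i; simp [hr i]
  have hrreg' : (D • r) 1 ≠ 0 ∨ (D • r) 2 ≠ 0 := by simpa [hD] using hrreg
  rw [← cV_smul k D hD r, ← mV_smul D hD r]
  have g0 : (D • r) 0 = β * p 0 := by rw [hr']; simp [he0]
  have g1 : (D • r) 1 = β * p 1 + α * e 1 := by rw [hr']
  have g2 : (D • r) 2 = β * p 2 + α * e 2 := by rw [hr']
  have g3 : (D • r) 3 = β * p 3 + α * e 3 := by rw [hr']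
  generalize D • r = R at *
  have R0 : R 0 ≠ 0 := by rw [g0]; exact mul_ne_zero hβ hp0
  unfold quadQ at *
  refine ⟨?_, by unfold mV; simp [he0, hp0, R0]⟩
  have hRQ : R 1 * R 2 + k * R 3 ^ 2 = 0 := by
    rw [g1, g2, g3]
    linear_combination β ^ 2 * hpQ + α * hB
  have hke := mul_ne_zero hk he
  unfold cV
  rw [if_pos he0, if_neg hp0, if_neg R0]
  by_cases h1 : p 1 = 0
  · have hp3 : p 3 = 0 := by
      have : k * p 3 ^ 2 = 0 := by rw [← hpQ, h1]; ring
      simpa [hk] using this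
    have hp2 : p 2 ≠ 0 := by tauto
    rw [if_pos h1]
    by_cases h2 : R 1 = 0
    · have hR2 : R 2 ≠ 0 := by tauto
      rw [if_pos h2]
      refine chi2_three _ _ _ (k * β * k * p 0 * (e 2 * p 3 - p 2 * e 3)) hke (by simp [*]) (by simp only [neg_mul, ne_eq, neg_eq_zero, mul_eq_zero, not_or]; tauto) ?_
      rw [g0, g2]
      linear_combination k ^ 3 * β * p 0 ^ 2 * (p 2 * e 2 * hB - β * e 2 ^ 2 * hpQ)
    · rw [if_neg h2]
      refine chi2_three _ _ _ (k * p 0 * α * (e 1 * e 2 + k * e 3 ^ 2)) hke (by simp [*]) (mul_ne_zero R0 h2) ?_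
      rw [g0, g1]
      have hB' : α * (e 1 * e 2 + k * e 3 ^ 2) + β * (e 1 * p 2) = 0 := by
        linear_combination hB - β * e 2 * h1 - 2 * k * β * e 3 * hp3
      rw [h1]
      linear_combination - k ^ 2 * p 0 ^ 2 * α * (e 1 * e 2 + k * e 3 ^ 2) * hB'
  · rw [if_neg h1]
    by_cases h2 : R 1 = 0
    · have hR2 : R 2 ≠ 0 := by tauto
      rw [if_pos h2]
      refine chi2_three _ _ _ (k * p 0 * α * (e 1 * e 2 + k * e 3 ^ 2)) hke (mul_ne_zero hp0 h1) (by simp only [neg_mul, ne_eq, neg_eq_zero, mul_eq_zero, not_or]; tauto) ?_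
      have hR3 : R 3 = 0 := by
        have : k * R 3 ^ 2 = 0 := by rw [← hRQ, h2]; ring
        simpa [hk] using this
      rw [g1] at h2
      rw [g3] at hR3
      have hY : e 1 * R 2 = α * (e 1 * e 2 + k * e 3 ^ 2) := by
        rw [g2]
        linear_combination hB - e 2 * h2 - 2 * k * e 3 * hR3
      rw [g0]
      linear_combination k ^ 2 * p 0 ^ 2 * (e 1 * e 2 + k * e 3 ^ 2) * (α * hY - R 2 * h2)
    · rw [if_neg h2]
      refine chi2_three _ _ _ (k * β * p 0 * (e 1 * p 3 - p 1 * e 3)) hke (mul_ne_zero hp0 h1) (mul_ne_zero R0 h2) ?_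
      rw [g0, g1]
      linear_combination k * β * p 0 ^ 2 * (p 1 * e 1 * hB - β * e 1 ^ 2 * hpQ)

theorem lineLem {F : Type*} [Field F] [Fintype F] (k : F) (hk : k ≠ 0)
    (a b : Fin 4 → F) (c : F) (hc : c ≠ 0) (se te sj tj sl tl : F)
    (hid : cubicF (C k : MvPolynomial (Fin 2) F) (fun j => C (a j) * X 0 + C (b j) * X 1) =
        C c * ((C te * (X 0 : MvPolynomial (Fin 2) F) - C se * X 1) *
          (C tj * (X 0 : MvPolynomial (Fin 2) F) - C sj * X 1) *
          (C tl * (X 0 : MvPolynomial (Fin 2) F) - C sl * X 1)))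
    (he0 : se * a 0 + te * b 0 = 0)
    (hne : a 0 ≠ 0 ∨ b 0 ≠ 0)
    (e p r : Fin 4 → F) (e_def : e = se • a + te • b) (p_def : p = sj • a + tj • b)
    (r_def : r = sl • a + tl • b) (hen : se ≠ 0 ∨ te ≠ 0)
    (ge : gradF k e ≠ 0) (gp : gradF k p ≠ 0) (gr : gradF k r ≠ 0) :
    cV F k e + cV F k p + cV F k r = 0 ∧ mV F e + mV F p + mV F r = 2 := by
  obtain ⟨m, hm, hma, hmb⟩ : ∃ m : F, m ≠ 0 ∧ a 0 = m * te ∧ b 0 = - (m * se) := by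
    by_cases ht : te = 0
    · have hs : se ≠ 0 := by tauto
      have ha : a 0 = 0 := by simpa [ht, hs] using he0
      refine ⟨- b 0 / se, ?_, by simp [ht, ha], by field_simp⟩
      have : b 0 ≠ 0 := by tauto
      simp [this, hs]
    · have hb : b 0 = - (a 0 / te * se) := by
        field_simp
        linear_combination he0
      refine ⟨a 0 / te, ?_, by field_simp, hb⟩
      intro h
      have : a 0 = 0 := by simpa [ht] using h
      simp [this] at hb
      tauto
  have hlin : (C te * (X 0 : MvPolynomial (Fin 2) F) - C se * X 1) ≠ 0 := by
    intro h
    have h1 := congrArg (MvPolynomial.eval ![1, 0]) h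
    have h2 := congrArg (MvPolynomial.eval ![0, 1]) h
    simp at h1 h2
    tauto
  have hq : C m * ((C (a 1) * X 0 + C (b 1) * X 1) * (C (a 2) * X 0 + C (b 2) * X 1) +
      C k * (C (a 3) * X 0 + C (b 3) * X 1) ^ 2) =
      C c * ((C tj * (X 0 : MvPolynomial (Fin 2) F) - C sj * X 1) *
          (C tl * (X 0 : MvPolynomial (Fin 2) F) - C sl * X 1)) := by
    apply mul_left_cancel₀ hlin
    unfold cubicF at hid
    simp only [hma, hmb, C_mul, C_neg] at hid
    linear_combination hid
  have hev : ∀ S T : F, m * ((a 1 * S + b 1 * T) * (a 2 * S + b 2 * T) +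
      k * (a 3 * S + b 3 * T) ^ 2) = c * ((tj * S - sj * T) * (tl * S - sl * T)) := by
    intro S T
    have := congrArg (MvPolynomial.eval ![S, T]) hq
    simpa using this
  clear hid hq hlin
  have ei : ∀ i, e i = se * a i + te * b i := by intro i; simp [e_def]
  have pi : ∀ i, p i = sj * a i + tj * b i := by intro i; simp [p_def]
  have ri : ∀ i, r i = sl * a i + tl * b i := by intro i; simp [r_def]
  have e0 : e 0 = 0 := by rw [ei, he0]
  have eQ : quadQ k e ≠ 0 := by
    intro h
    apply ge
    unfold quadQ at h
    unfold gradF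
    rw [h, e0]
    funext i; fin_cases i <;> simp
  have mQe : m * quadQ k e = c * (te * sj - se * tj) * (te * sl - se * tl) := by
    have := hev se te
    unfold quadQ
    rw [ei, ei, ei]
    linear_combination this
  have hnz : c * (te * sj - se * tj) * (te * sl - se * tl) ≠ 0 := by
    rw [← mQe]; exact mul_ne_zero hm eQ
  have hD : te * sj - se * tj ≠ 0 := by intro h; simp [h] at hnz
  have hβ : te * sl - se * tl ≠ 0 := by intro h; simp [h] at hnz
  have p0 : p 0 ≠ 0 := by
    have : p 0 = m * (te * sj - se * tj) := by rw [pi, hma, hmb]; ring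
    rw [this]; exact mul_ne_zero hm hD
  have pQ : quadQ k p = 0 := by
    have := hev sj tj
    apply mul_left_cancel₀ hm
    unfold quadQ
    rw [pi, pi, pi]
    linear_combination this
  have rQ : quadQ k r = 0 := by
    have := hev sl tl
    apply mul_left_cancel₀ hm
    unfold quadQ
    rw [ri, ri, ri]
    linear_combination this
  have hreg : ∀ v : Fin 4 → F, quadQ k v = 0 → gradF k v ≠ 0 → v 1 ≠ 0 ∨ v 2 ≠ 0 := by
    intro v hv hg
    by_contra! hcon
    apply hg
    have h3 : v 3 = 0 := by
      have : k * v 3 ^ 2 = 0 := by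
        unfold quadQ at hv
        rw [← hv, hcon.1]; ring
      simpa [hk] using this
    unfold gradF
    funext i; fin_cases i <;> simp [h3, hcon.1, hcon.2]
  refine core k hk e p r (tl * sj - tj * sl) (te * sl - se * tl) (te * sj - se * tj) hD hβ e0 eQ p0 pQ
    ?_ ?_ (hreg p pQ gp) (hreg r rQ gr)
  · intro i; rw [ei, pi, ri]; ring
  · have mB : m * (e 1 * p 2 + e 2 * p 1 + 2 * k * e 3 * p 3) =
        - (c * (te * sj - se * tj) * (tl * sj - tj * sl)) := by
      have h1 := hev (se + sj) (te + tj)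
      have h2 := hev se te
      have h3 := hev sj tj
      simp only [ei, pi]
      linear_combination h1 - h2 - h3
    apply mul_left_cancel₀ hm
    linear_combination (tl * sj - tj * sl) * mQe + (te * sl - se * tl) * mB

theorem gradF_smul {F : Type*} [Field F] (k u : F) (v : Fin 4 → F) (hv : gradF k (u • v) ≠ 0) :
    gradF k v ≠ 0 := by
  have : gradF k (u • v) = u ^ 2 • gradF k v := by
    unfold gradF
    funext i; fin_cases i <;> simp <;> ring
  intro h
  rw [this, h] at hv
  simp at hv

theorem colLem {F : Type*} [Field F] [Fintype F] (k : F) (hk : k ≠ 0) (x : Fin 3 → Reg F k)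
    (h : Col F k (fun i => (x i).1)) :
    cComp F k (x 0) + cComp F k (x 1) + cComp F k (x 2) = 0 ∧
    mComp F k (x 0) + mComp F k (x 1) + mComp F k (x 2) = 2 := by
  obtain ⟨a, b, -, c, hc, s, t, hpt, hid⟩ := h
  have hP : ∀ i, cComp F k (x i) = cV F k (s i • a + t i • b) ∧
      mComp F k (x i) = mV F (s i • a + t i • b) ∧ gradF k (s i • a + t i • b) ≠ 0 ∧
      (s i ≠ 0 ∨ t i ≠ 0) := by
    intro i
    obtain ⟨hne, hmk⟩ := hpt i
    obtain ⟨u, hu⟩ := Projectivization.exists_smul_eq_mk_rep F _ hne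
    rw [hmk] at hu
    have hu0 : (u : F) ≠ 0 := u.ne_zero
    have hu' : (u : F) • (s i • a + t i • b) = (x i).1.rep := hu
    refine ⟨?_, ?_, ?_, ?_⟩
    · rw [← cV_smul k u hu0, hu']; rfl
    · rw [← mV_smul (u : F) hu0, hu']; rfl
    · apply gradF_smul k u
      rw [hu']; exact (x i).2.2
    · by_contra! hcon
      simp [hcon.1, hcon.2] at hne
  have hne : a 0 ≠ 0 ∨ b 0 ≠ 0 := by
    by_contra! hcon
    have hz : (C c * ∏ i : Fin 3,
          (C (t i) * (X 0 : MvPolynomial (Fin 2) F) - C (s i) * X 1)) = 0 := by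
      rw [← hid]; unfold cubicF; simp [hcon.1, hcon.2]
    rw [mul_eq_zero, Finset.prod_eq_zero_iff] at hz
    rcases hz with hz | ⟨i, -, hz⟩
    · simp [hc] at hz
    · have h1 := congrArg (MvPolynomial.eval ![1, 0]) hz
      have h2 := congrArg (MvPolynomial.eval ![0, 1]) hz
      simp at h1 h2
      have := (hP i).2.2.2
      tauto
  rw [Fin.prod_univ_three] at hid
  have hroot := congrArg (MvPolynomial.eval ![b 0, - a 0]) hid
  unfold cubicF at hroot
  simp only [map_mul, map_add, map_sub, eval_C, eval_X, map_pow, Matrix.cons_val_zero, Matrix.cons_val_one] at hroot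
  have hr : (s 0 * a 0 + t 0 * b 0) * (s 1 * a 0 + t 1 * b 0) * (s 2 * a 0 + t 2 * b 0) = 0 := by
    apply mul_left_cancel₀ hc
    linear_combination - hroot
  simp only [(hP _).1, (hP _).2.1]
  rcases mul_eq_zero.1 hr with hr | h2
  · rcases mul_eq_zero.1 hr with h0 | h1
    · exact lineLem k hk a b c hc (s 0) (t 0) (s 1) (t 1) (s 2) (t 2) hid h0 hne _ _ _ rfl rfl rfl
        (hP 0).2.2.2 (hP 0).2.2.1 (hP 1).2.2.1 (hP 2).2.2.1
    · have := lineLem k hk a b c hc (s 1) (t 1) (s 0) (t 0) (s 2) (t 2)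
        (by rw [hid]; ring) h1 hne _ _ _ rfl rfl rfl
        (hP 1).2.2.2 (hP 1).2.2.1 (hP 0).2.2.1 (hP 2).2.2.1
      exact ⟨by rw [← this.1]; ring, by rw [← this.2]; ring⟩
  · have := lineLem k hk a b c hc (s 2) (t 2) (s 0) (t 0) (s 1) (t 1)
        (by rw [hid]; ring) h2 hne _ _ _ rfl rfl rfl
        (hP 2).2.2.2 (hP 2).2.2.1 (hP 0).2.2.1 (hP 1).2.2.1
    exact ⟨by rw [← this.1]; ring, by rw [← this.2]; ring⟩

theorem exPt {F : Type*} [Field F] (k : F) (v : Fin 4 → F) (hv : v ≠ 0)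
    (h0 : cubicF k v = 0) (hg : gradF k v ≠ 0) :
    ∃ p : Reg F k, cComp F k p = cV F k v ∧ mComp F k p = mV F v := by
  obtain ⟨u, hu⟩ := Projectivization.exists_smul_eq_mk_rep F v hv
  have hu0 : (u : F) ≠ 0 := u.ne_zero
  have hu' : (u : F) • v = (Projectivization.mk F v hv).rep := hu
  refine ⟨⟨Projectivization.mk F v hv, ?_, ?_⟩, ?_, ?_⟩
  · rw [← hu']
    have : cubicF k ((u : F) • v) = (u : F) ^ 3 * cubicF k v := by
      unfold cubicF; simp; ring
    rw [this, h0, mul_zero]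
  · apply gradF_smul k (u : F)⁻¹
    rw [← hu', smul_smul, inv_mul_cancel₀ hu0, one_smul]
    exact hg
  · exact (congrArg (cV F k) hu'.symm).trans (cV_smul k u hu0 v)
  · exact (congrArg (mV F) hu'.symm).trans (mV_smul (u : F) hu0 v)

end MWaux

/-- for `q` an odd prime power, `k ∈ F_q` nonzero and `V ⊂ P³` the reducible
cubic surface `x(yz + kw²) = 0`, there is a surjective group homomorphism
`MW(V) → ℤ ⊕ ℤ/2ℤ` whose components are induced by the point maps `mComp` and `cComp`. -/
theorem MW_surjects_onto_Z_times_Z2 (q : ℕ) (hq : Odd q)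
    (F : Type*) [Field F] [Fintype F] (hcard : Fintype.card F = q)
    (k : F) (hk : k ≠ 0) :
    ∃ φ : ↥(MW F k) →+ ℤ × ZMod 2, Function.Surjective φ ∧
      ∀ (x y : Reg F k)
        (h : QuotientAddGroup.mk' (Nsub F k)
              (FreeAbelianGroup.of x - FreeAbelianGroup.of y) ∈ MW F k),
        φ ⟨_, h⟩ = (mComp F k x - mComp F k y, cComp F k x - cComp F k y) := by
  classical
  let Ψ : FreeAbelianGroup (Reg F k) →+ ℤ × ZMod 2 :=
    FreeAbelianGroup.lift fun p => (mComp F k p, cComp F k p)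
  have hΨ : ∀ p, Ψ (FreeAbelianGroup.of p) = (mComp F k p, cComp F k p) := fun p =>
    FreeAbelianGroup.lift_apply_of _ _
  have hker : Nsub F k ≤ Ψ.ker := by
    unfold Nsub
    rw [AddSubgroup.closure_le]
    rintro g ⟨x, y, hx, hy, rfl⟩
    have h1 := MWaux.colLem k hk x hx
    have h2 := MWaux.colLem k hk y hy
    simp only [SetLike.mem_coe, AddMonoidHom.mem_ker, map_sub, map_add, hΨ]
    ext
    · simp only [Prod.fst_sub, Prod.fst_add, Prod.fst_zero]
      linear_combination h1.2 - h2.2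
    · simp only [Prod.snd_sub, Prod.snd_add, Prod.snd_zero]
      linear_combination h1.1 - h2.1
  let Φ : FreeAbelianGroup (Reg F k) ⧸ Nsub F k →+ ℤ × ZMod 2 := QuotientAddGroup.lift _ Ψ hker
  have hΦ : ∀ g, Φ (QuotientAddGroup.mk' (Nsub F k) g) = Ψ g := fun g => rfl
  refine ⟨Φ.comp (MW F k).subtype, ?_, ?_⟩
  · have hchar : ringChar F ≠ 2 := by
      intro h
      have := FiniteField.even_card_of_char_two h
      rw [hcard] at this
      have h2 := Nat.odd_iff.1 hq
      omega
    obtain ⟨n, hn⟩ := FiniteField.exists_nonsquare hchar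
    have hn0 : n ≠ 0 := by
      rintro rfl
      exact hn (IsSquare.zero)
    have hcone : ∀ y : F, y ≠ 0 → ∃ p : Reg F k, cComp F k p = chi2 F y ∧ mComp F k p = 1 := by
      intro y hy
      obtain ⟨p, hp1, hp2⟩ := MWaux.exPt k ![1, y, 0, 0]
        (fun h => by simpa using congrFun h 0) (by simp [cubicF])
        (fun h => hy (by simpa [gradF] using congrFun h 2))
      exact ⟨p, by rw [hp1]; simp [MWaux.cV, hy], by rw [hp2]; simp [MWaux.mV]⟩
    obtain ⟨p1, hp1c, hp1m⟩ := hcone 1 one_ne_zero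
    obtain ⟨pn, hpnc, hpnm⟩ := hcone n hn0
    obtain ⟨e, hec, hem⟩ := MWaux.exPt k ![0, 0, 0, 1]
        (fun h => by simpa using congrFun h 3) (by simp [cubicF])
        (fun h => hk (by simpa [gradF] using congrFun h 0))
    have hec' : cComp F k e = 0 := by rw [hec]; simp [MWaux.cV, chi2]
    have hem' : mComp F k e = 0 := by rw [hem]; simp [MWaux.mV]
    have hp1c' : cComp F k p1 = 0 := by rw [hp1c]; simp [chi2]
    have hpnc' : cComp F k pn = 1 := by rw [hpnc]; simp [chi2, hn]
    rintro ⟨A, B⟩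
    let g : FreeAbelianGroup (Reg F k) :=
      A • (FreeAbelianGroup.of p1 - FreeAbelianGroup.of e) +
      (B.val : ℤ) • (FreeAbelianGroup.of pn - FreeAbelianGroup.of p1)
    have hg : g ∈ (aug F k).ker := by
      simp [g, aug, AddMonoidHom.mem_ker]
    refine ⟨⟨QuotientAddGroup.mk' (Nsub F k) g, AddSubgroup.mem_map_of_mem _ hg⟩, ?_⟩
    change Ψ g = _
    simp only [g, map_add, map_zsmul, map_sub, hΨ, hec', hem', hp1c', hp1m, hpnc', hpnm]
    ext <;> simp
  · intro x y h
    change Ψ (FreeAbelianGroup.of x - FreeAbelianGroup.of y) = _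
    rw [map_sub, hΨ, hΨ]
    rfl
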